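/- If a totally ordered triplet (X,Y,Z) of random variables on a common finite probability space is geodesic, i.e. V(X,Z) = V(X,Y) + V(Y,Z), then (X,Y,Z) form a Markov chain (I(X;Z|Y) = 0) and the 3-mutual information is nonnegative; in fact I₃(X;Y;Z) = I(X;Z) ≥ 0. -/

import Mathlib

open Finset

structure FinProb (Ω : Type*) [Fintype Ω] where
  p : Ω → ℝ
  nonneg : ∀ ω, 0 ≤ p ω
  sum_one : ∑ ω, p ω = 1

noncomputable def pmf {Ω α : Type*} [Fintype Ω] [DecidableEq α]
    (P : FinProb Ω) (X : Ω → α) (x : α) : ℝ :=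
  ∑ ω ∈ Finset.univ.filter (fun ω => X ω = x), P.p ω

noncomputable def ent {Ω α : Type*} [Fintype Ω] [Fintype α] [DecidableEq α]
    (c : ℝ) (P : FinProb Ω) (X : Ω → α) : ℝ :=
  -∑ x : α, pmf P X x * Real.logb c (pmf P X x)

noncomputable def jent2 {Ω α β : Type*} [Fintype Ω] [Fintype α] [DecidableEq α]
    [Fintype β] [DecidableEq β] (c : ℝ) (P : FinProb Ω) (X : Ω → α) (Y : Ω → β) : ℝ :=
  ent c P (fun ω => (X ω, Y ω))

noncomputable def jent3 {Ω α β γ : Type*} [Fintype Ω] [Fintype α] [DecidableEq α]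
    [Fintype β] [DecidableEq β] [Fintype γ] [DecidableEq γ]
    (c : ℝ) (P : FinProb Ω) (X : Ω → α) (Y : Ω → β) (Z : Ω → γ) : ℝ :=
  ent c P (fun ω => (X ω, Y ω, Z ω))

noncomputable def mi {Ω α β : Type*} [Fintype Ω] [Fintype α] [DecidableEq α]
    [Fintype β] [DecidableEq β] (c : ℝ) (P : FinProb Ω) (X : Ω → α) (Y : Ω → β) : ℝ :=
  ent c P X + ent c P Y - jent2 c P X Y

noncomputable def infoDist {Ω α β : Type*} [Fintype Ω] [Fintype α] [DecidableEq α]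
    [Fintype β] [DecidableEq β] (c : ℝ) (P : FinProb Ω) (X : Ω → α) (Y : Ω → β) : ℝ :=
  jent2 c P X Y - mi c P X Y

/-- Conditional entropy `H(X|Y)`. -/
noncomputable def condEnt {Ω α β : Type*} [Fintype Ω] [Fintype α] [DecidableEq α]
    [Fintype β] [DecidableEq β] (c : ℝ) (P : FinProb Ω) (X : Ω → α) (Y : Ω → β) : ℝ :=
  jent2 c P X Y - ent c P Y

/-- Conditional mutual information `I(X;Z|Y)`. -/
noncomputable def cmi {Ω α β γ : Type*} [Fintype Ω] [Fintype α] [DecidableEq α]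
    [Fintype β] [DecidableEq β] [Fintype γ] [DecidableEq γ]
    (c : ℝ) (P : FinProb Ω) (X : Ω → α) (Z : Ω → γ) (Y : Ω → β) : ℝ :=
  jent2 c P X Y + jent2 c P Y Z - ent c P Y - jent3 c P X Y Z

/-- The 3-mutual information `I₃(X;Y;Z)`. -/
noncomputable def mi3 {Ω α β γ : Type*} [Fintype Ω] [Fintype α] [DecidableEq α]
    [Fintype β] [DecidableEq β] [Fintype γ] [DecidableEq γ]
    (c : ℝ) (P : FinProb Ω) (X : Ω → α) (Y : Ω → β) (Z : Ω → γ) : ℝ :=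
  ent c P X + ent c P Y + ent c P Z - jent2 c P X Y - jent2 c P X Z - jent2 c P Y Z +
    jent3 c P X Y Z

lemma sum_pmf_mul {Ω α : Type*} [Fintype Ω] [Fintype α] [DecidableEq α]
    (P : FinProb Ω) (X : Ω → α) (f : α → ℝ) :
    ∑ x, pmf P X x * f x = ∑ ω, P.p ω * f (X ω) := by
  rw [← Finset.sum_fiberwise (s := Finset.univ) (g := X)]
  refine Finset.sum_congr rfl fun x _ => ?_
  rw [pmf, Finset.sum_mul]
  refine Finset.sum_congr rfl fun ω hω => ?_
  rw [(Finset.mem_filter.1 hω).2]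

lemma ent_eq {Ω α : Type*} [Fintype Ω] [Fintype α] [DecidableEq α]
    (c : ℝ) (P : FinProb Ω) (X : Ω → α) :
    ent c P X = -∑ ω, P.p ω * Real.logb c (pmf P X (X ω)) := by
  rw [ent, sum_pmf_mul P X (fun x => Real.logb c (pmf P X x))]

lemma pmf_nonneg {Ω α : Type*} [Fintype Ω] [DecidableEq α]
    (P : FinProb Ω) (X : Ω → α) (x : α) : 0 ≤ pmf P X x :=
  Finset.sum_nonneg fun ω _ => P.nonneg ω

lemma le_pmf {Ω α : Type*} [Fintype Ω] [DecidableEq α]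
    (P : FinProb Ω) (X : Ω → α) (ω : Ω) : P.p ω ≤ pmf P X (X ω) :=
  Finset.single_le_sum (f := P.p) (fun ω _ => P.nonneg ω) (by simp)

lemma pmf_mono {Ω α β : Type*} [Fintype Ω] [DecidableEq α] [DecidableEq β]
    (P : FinProb Ω) (X : Ω → α) (Y : Ω → β) (x : α) (y : β)
    (h : ∀ ω, X ω = x → Y ω = y) : pmf P X x ≤ pmf P Y y := by
  refine Finset.sum_le_sum_of_subset_of_nonneg ?_ fun ω _ _ => P.nonneg ω
  intro ω hω
  simp only [Finset.mem_filter, Finset.mem_univ, true_and] at hω ⊢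
  exact h ω hω

lemma ent_mono {Ω α β : Type*} [Fintype Ω] [Fintype α] [DecidableEq α]
    [Fintype β] [DecidableEq β] (c : ℝ) (hc : 1 < c)
    (P : FinProb Ω) (X : Ω → α) (Y : Ω → β)
    (h : ∀ ω ω', X ω = X ω' → Y ω = Y ω') : ent c P Y ≤ ent c P X := by
  rw [ent_eq, ent_eq]
  apply neg_le_neg
  refine Finset.sum_le_sum fun ω _ => ?_
  rcases (P.nonneg ω).eq_or_lt with h0 | h0
  · simp [← h0]
  · refine mul_le_mul_of_nonneg_left ?_ h0.le
    exact Real.logb_le_logb_of_le hc (h0.trans_le (le_pmf P X ω))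
      (pmf_mono P X Y _ _ fun ω' h' => h _ _ h')

lemma sum_pmf {Ω α : Type*} [Fintype Ω] [Fintype α] [DecidableEq α]
    (P : FinProb Ω) (X : Ω → α) : ∑ x, pmf P X x = 1 := by
  have := sum_pmf_mul P X (fun _ => 1)
  simpa [P.sum_one] using this

lemma sum_pmf_left {Ω α β : Type*} [Fintype Ω] [Fintype α] [DecidableEq α] [DecidableEq β]
    (P : FinProb Ω) (X : Ω → α) (Y : Ω → β) (y : β) :
    ∑ x, pmf P (fun ω => (X ω, Y ω)) (x, y) = pmf P Y y := by
  rw [pmf, ← Finset.sum_fiberwise (s := Finset.univ.filter fun ω => Y ω = y) (g := X)]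
  refine Finset.sum_congr rfl fun x _ => ?_
  rw [pmf, Finset.filter_filter]
  refine Finset.sum_congr ?_ fun _ _ => rfl
  ext ω
  simp [and_comm]

lemma sum_pmf_right {Ω α β : Type*} [Fintype Ω] [Fintype α] [DecidableEq α] [DecidableEq β]
    (P : FinProb Ω) (X : Ω → α) (Y : Ω → β) (y : β) :
    ∑ x, pmf P (fun ω => (Y ω, X ω)) (y, x) = pmf P Y y := by
  rw [← sum_pmf_left P X Y y]
  refine Finset.sum_congr rfl fun x _ => ?_
  rw [pmf, pmf]
  refine Finset.sum_congr ?_ fun _ _ => rfl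
  ext ω
  simp [and_comm]

lemma cmi_nonneg {Ω α β γ : Type*} [Fintype Ω] [Fintype α] [DecidableEq α]
    [Fintype β] [DecidableEq β] [Fintype γ] [DecidableEq γ]
    (c : ℝ) (hc : 1 < c) (P : FinProb Ω) (X : Ω → α) (Y : Ω → β) (Z : Ω → γ) :
    0 ≤ cmi c P X Z Y := by
  have hlc : 0 < Real.log c := Real.log_pos hc
  set q : α × β × γ → ℝ := pmf P (fun ω => (X ω, Y ω, Z ω)) with hq
  set a : α × β → ℝ := pmf P (fun ω => (X ω, Y ω)) with ha
  set b : β × γ → ℝ := pmf P (fun ω => (Y ω, Z ω)) with hb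
  set r : β → ℝ := pmf P Y with hr
  have hq0 : ∀ w, 0 ≤ q w := pmf_nonneg P _
  have ha0 : ∀ w, 0 ≤ a w := pmf_nonneg P _
  have hb0 : ∀ w, 0 ≤ b w := pmf_nonneg P _
  have hr0 : ∀ w, 0 ≤ r w := pmf_nonneg P _
  let g : α × β × γ → ℝ := fun w => a (w.1, w.2.1) * b w.2 / (q w * r w.2.1)
  have key : ∑ ω, P.p ω * g (X ω, Y ω, Z ω) ≤ 1 := by
    rw [← sum_pmf_mul P (fun ω => (X ω, Y ω, Z ω)) g]
    calc ∑ w, q w * g w ≤ ∑ w : α × β × γ, a (w.1, w.2.1) * b w.2 / r w.2.1 := by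
          refine Finset.sum_le_sum fun w _ => ?_
          rcases (hq0 w).eq_or_lt with h0 | h0
          · rw [← h0, zero_mul]
            exact div_nonneg (mul_nonneg (ha0 _) (hb0 _)) (hr0 _)
          · apply le_of_eq
            simp only [g]
            rw [mul_div_assoc', mul_div_mul_left _ _ h0.ne']
      _ = ∑ y, r y := by
          rw [Fintype.sum_prod_type, Finset.sum_congr rfl fun x _ => Fintype.sum_prod_type _,
            Finset.sum_comm]
          refine Finset.sum_congr rfl fun y _ => ?_
          have h1 : ∑ x, a (x, y) = r y := sum_pmf_left P X Y y
          have h2 : ∑ z, b (y, z) = r y := sum_pmf_right P Z Y y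
          simp only
          simp_rw [← Finset.sum_div, ← Finset.mul_sum, ← Finset.sum_mul]
          rw [h1, h2, mul_self_div_self]
      _ = 1 := sum_pmf P Y
  have hmain : ∑ ω, P.p ω * ((1 - g (X ω, Y ω, Z ω)) / Real.log c) ≤ cmi c P X Z Y := by
    have e : cmi c P X Z Y = ∑ ω, P.p ω * (Real.logb c (q (X ω, Y ω, Z ω)) +
        Real.logb c (r (Y ω)) - Real.logb c (a (X ω, Y ω)) - Real.logb c (b (Y ω, Z ω))) := by
      simp only [cmi, jent2, jent3, ent_eq, mul_add, mul_sub, Finset.sum_add_distrib,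
        Finset.sum_sub_distrib]
      ring
    rw [e]
    refine Finset.sum_le_sum fun ω _ => ?_
    rcases (P.nonneg ω).eq_or_lt with h0 | h0
    · simp [← h0]
    · refine mul_le_mul_of_nonneg_left ?_ h0.le
      have q1 : 0 < q (X ω, Y ω, Z ω) := h0.trans_le (le_pmf P (fun ω => (X ω, Y ω, Z ω)) ω)
      have a1 : 0 < a (X ω, Y ω) := h0.trans_le (le_pmf P (fun ω => (X ω, Y ω)) ω)
      have b1 : 0 < b (Y ω, Z ω) := h0.trans_le (le_pmf P (fun ω => (Y ω, Z ω)) ω)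
      have r1 : 0 < r (Y ω) := h0.trans_le (le_pmf P Y ω)
      have hl := Real.log_le_sub_one_of_pos (div_pos (mul_pos a1 b1) (mul_pos q1 r1))
      rw [Real.log_div (by positivity) (by positivity), Real.log_mul a1.ne' b1.ne',
        Real.log_mul q1.ne' r1.ne'] at hl
      simp only [Real.logb, ← add_div, ← sub_div]
      refine div_le_div_of_nonneg_right ?_ hlc.le
      simp only [g]
      linarith
  refine le_trans ?_ hmain
  have e2 : ∑ ω, P.p ω * ((1 - g (X ω, Y ω, Z ω)) / Real.log c) =
      (1 - ∑ ω, P.p ω * g (X ω, Y ω, Z ω)) / Real.log c := by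
    rw [← P.sum_one, ← Finset.sum_sub_distrib, Finset.sum_div]
    refine Finset.sum_congr rfl fun ω _ => ?_
    rw [P.sum_one]
    ring
  rw [e2]
  exact div_nonneg (by linarith) hlc.le

lemma mi_nonneg {Ω α γ : Type*} [Fintype Ω] [Fintype α] [DecidableEq α]
    [Fintype γ] [DecidableEq γ]
    (c : ℝ) (hc : 1 < c) (P : FinProb Ω) (X : Ω → α) (Z : Ω → γ) :
    0 ≤ mi c P X Z := by
  have h := cmi_nonneg c hc P X (fun _ => ()) Z
  have h1 : jent2 c P X (fun _ => ()) ≤ ent c P X :=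
    ent_mono c hc P _ _ fun ω ω' h => by simp [h]
  have h2 : jent2 c P (fun _ => ()) Z ≤ ent c P Z :=
    ent_mono c hc P _ _ fun ω ω' h => by simp [h]
  have h3 : jent2 c P X Z ≤ jent3 c P X (fun _ => ()) Z :=
    ent_mono c hc P _ _ fun ω ω' h => by simpa using h
  have h4 : ent c P (fun _ : Ω => ()) = 0 := by
    rw [ent_eq]
    simp [pmf, P.sum_one]
  rw [cmi] at h
  rw [mi]
  linarith

/-- if `(X,Y,Z)` is geodesic then it is a Markov chain
(`I(X;Z|Y) = 0`) and `I₃(X;Y;Z) = I(X;Z) ≥ 0`. -/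
theorem geodesic_markov_mi3 {Ω α β γ : Type*} [Fintype Ω] [Fintype α] [DecidableEq α]
    [Fintype β] [DecidableEq β] [Fintype γ] [DecidableEq γ]
    (c : ℝ) (hc : 1 < c) (P : FinProb Ω) (X : Ω → α) (Y : Ω → β) (Z : Ω → γ)
    (hgeo : infoDist c P X Z = infoDist c P X Y + infoDist c P Y Z) :
    cmi c P X Z Y = 0 ∧ mi3 c P X Y Z = mi c P X Z ∧ 0 ≤ mi3 c P X Y Z := by
  have h1 := cmi_nonneg c hc P X Y Z
  have h2 : jent2 c P X Z ≤ jent3 c P X Y Z :=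
    ent_mono c hc P _ _ fun ω ω' h => by
      simp only [Prod.mk.injEq] at h ⊢
      exact ⟨h.1, h.2.2⟩
  have h3 := mi_nonneg c hc P X Z
  have h4 : cmi c P X Z Y = 0 := by
    simp only [infoDist, mi] at hgeo
    simp only [cmi] at h1 ⊢
    linarith
  have h5 : mi3 c P X Y Z = mi c P X Z := by
    simp only [cmi] at h4
    simp only [mi3, mi]
    linarith
  exact ⟨h4, h5, h5 ▸ h3⟩
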